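/- arXiv:2109.14541 — 3 statements merged into one kernel-verified Lean document; each statement's English description precedes it below -/
import Mathlib

section
/- Let 0 < p < 1, and set α = p³(2+p)/(1+2p) and β = (27/4)·p²(1+p)²/(1+p+p²)³. Then (1 + p + p²)·F(1/2, 1/2; 1; α) = √(1+2p)·F(1/3, 2/3; 1; β). -/
/-- The Gauss hypergeometric series `F(a, b; c; x) = ∑ (a)_n (b)_n / ((c)_n n!) xⁿ`,
where `(q)_n` is the rising Pochhammer symbol. -/
noncomputable def hypF (a b c x : ℝ) : ℝ :=
  ∑' n : ℕ, ((ascPochhammer ℝ n).eval a * (ascPochhammer ℝ n).eval b /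
    ((ascPochhammer ℝ n).eval c * (Nat.factorial n))) * x ^ n

/-- The real power series with coefficients `c`. -/
noncomputable def powerSum (c : ℕ → ℝ) (x : ℝ) : ℝ := ∑' n, c n * x ^ n

/-- The coefficients of `x` times the power series with coefficients `c`. -/
def shiftCoeff (c : ℕ → ℝ) : ℕ → ℝ
  | 0 => 0
  | n + 1 => c n

/-- The coefficients of the termwise derivative. -/
def derivCoeff (c : ℕ → ℝ) (n : ℕ) : ℝ := (n + 1) * c (n + 1)

/-- Polynomial growth of a coefficient sequence. -/
def PolyBounded (c : ℕ → ℝ) : Prop := ∃ (C : ℝ) (k : ℕ), ∀ n, |c n| ≤ C * (n + 1 : ℝ) ^ k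

lemma summable_succ_pow_mul_geometric (k : ℕ) {r : ℝ} (hr0 : 0 < r) (hr1 : r < 1) :
    Summable fun n : ℕ => (n + 1 : ℝ) ^ k * r ^ n := by
  have h := summable_pow_mul_geometric_of_norm_lt_one k (r := r)
    (by rwa [Real.norm_of_nonneg hr0.le])
  have h1 := ((summable_nat_add_iff 1).2 h).mul_right r⁻¹
  refine h1.congr fun n => ?_
  rw [pow_succ, ← mul_assoc, mul_inv_cancel_right₀ hr0.ne', Nat.cast_succ]

lemma PolyBounded.summable {c : ℕ → ℝ} (hc : PolyBounded c) {x : ℝ} (hx : |x| < 1) :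
    Summable fun n => c n * x ^ n := by
  obtain ⟨C, k, hC⟩ := hc
  obtain ⟨r, hxr, hr1⟩ := exists_between hx
  have hr0 : 0 < r := (abs_nonneg x).trans_lt hxr
  refine Summable.of_norm_bounded
    ((summable_succ_pow_mul_geometric k hr0 hr1).mul_left C) fun n => ?_
  rw [norm_mul, norm_pow, Real.norm_eq_abs, Real.norm_eq_abs, ← mul_assoc]
  have := hC n
  exact mul_le_mul this (pow_le_pow_left₀ (abs_nonneg x) hxr.le n) (by positivity)
    ((abs_nonneg _).trans this)

lemma PolyBounded.derivCoeff {c : ℕ → ℝ} (hc : PolyBounded c) : PolyBounded (derivCoeff c) := by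
  obtain ⟨C, k, hC⟩ := hc
  have hC0 : 0 ≤ C := by simpa using (abs_nonneg _).trans (hC 0)
  refine ⟨C * 2 ^ k, k + 1, fun n => ?_⟩
  have h := hC (n + 1)
  push_cast at h
  have h2 : ((n : ℝ) + 1 + 1) ^ k ≤ (2 * (n + 1)) ^ k :=
    pow_le_pow_left₀ (by positivity) (by linarith [(n.cast_nonneg : (0 : ℝ) ≤ n)]) k
  rw [_root_.derivCoeff, abs_mul, abs_of_nonneg (by positivity : (0 : ℝ) ≤ n + 1)]
  calc ((n : ℝ) + 1) * |c (n + 1)| ≤ (n + 1) * (C * (2 * (n + 1)) ^ k) :=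
        mul_le_mul_of_nonneg_left (h.trans (mul_le_mul_of_nonneg_left h2 hC0)) (by positivity)
    _ = C * 2 ^ k * (n + 1) ^ (k + 1) := by rw [mul_pow]; ring

lemma PolyBounded.shiftCoeff {c : ℕ → ℝ} (hc : PolyBounded c) : PolyBounded (shiftCoeff c) := by
  obtain ⟨C, k, hC⟩ := hc
  have hC0 : 0 ≤ C := by simpa using (abs_nonneg _).trans (hC 0)
  refine ⟨C, k, fun n => ?_⟩
  cases n with
  | zero => simpa [_root_.shiftCoeff] using hC0
  | succ n =>
    refine (hC n).trans ?_
    push_cast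
    gcongr
    linarith

lemma PolyBounded.sub {c d : ℕ → ℝ} (hc : PolyBounded c) (hd : PolyBounded d) :
    PolyBounded (c - d) := by
  obtain ⟨C, k, hC⟩ := hc
  obtain ⟨D, l, hD⟩ := hd
  have hC0 : 0 ≤ C := by simpa using (abs_nonneg _).trans (hC 0)
  have hD0 : 0 ≤ D := by simpa using (abs_nonneg _).trans (hD 0)
  refine ⟨C + D, k + l, fun n => ?_⟩
  have h1 : (1 : ℝ) ≤ n + 1 := by linarith [(n.cast_nonneg : (0 : ℝ) ≤ n)]
  calc |c n - d n| ≤ |c n| + |d n| := abs_sub _ _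
    _ ≤ C * (n + 1 : ℝ) ^ k + D * (n + 1 : ℝ) ^ l := add_le_add (hC n) (hD n)
    _ ≤ C * (n + 1 : ℝ) ^ (k + l) + D * (n + 1 : ℝ) ^ (k + l) := by
      gcongr <;> first | exact h1 | omega
    _ = _ := by ring

lemma powerSum_shiftCoeff {c : ℕ → ℝ} (hc : PolyBounded c) {x : ℝ} (hx : |x| < 1) :
    powerSum (shiftCoeff c) x = x * powerSum c x := by
  rw [powerSum, (hc.shiftCoeff.summable hx).tsum_eq_zero_add, powerSum, ← tsum_mul_left]
  simp only [shiftCoeff, zero_mul, zero_add]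
  exact tsum_congr fun n => by ring

lemma powerSum_sub {c d : ℕ → ℝ} (hc : PolyBounded c) (hd : PolyBounded d) {x : ℝ}
    (hx : |x| < 1) : powerSum (c - d) x = powerSum c x - powerSum d x := by
  rw [powerSum, powerSum, powerSum, ← (hc.summable hx).tsum_sub (hd.summable hx)]
  exact tsum_congr fun n => by simp [sub_mul]

lemma hasDerivAt_powerSum {c : ℕ → ℝ} (hc : PolyBounded c) {x : ℝ} (hx : |x| < 1) :
    HasDerivAt (powerSum c) (powerSum (derivCoeff c) x) x := by
  obtain ⟨r, hxr, hr1⟩ := exists_between hx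
  have hr0 : 0 < r := (abs_nonneg x).trans_lt hxr
  have hsum : Summable fun n : ℕ => |c n * (n * r ^ (n - 1))| := by
    rw [← summable_nat_add_iff 1]
    refine (hc.derivCoeff.summable (x := r) (by rwa [abs_of_pos hr0])).abs.congr fun n => ?_
    simp only [derivCoeff, Nat.add_sub_cancel]
    push_cast
    congr 1
    ring
  have hbound : ∀ (n : ℕ) (y : ℝ), y ∈ Metric.ball (0 : ℝ) r →
      ‖c n * (n * y ^ (n - 1))‖ ≤ |c n * (n * r ^ (n - 1))| := fun n y hy => by
    have hy' : |y| ≤ r := by simpa using (Metric.mem_ball.1 hy).le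
    rw [Real.norm_eq_abs, abs_mul, abs_mul, abs_mul, abs_mul, abs_pow, abs_pow, abs_of_pos hr0]
    gcongr
  have hxb : x ∈ Metric.ball (0 : ℝ) r := by simpa using hxr
  have h := hasDerivAt_tsum_of_isPreconnected (g := fun n y => c n * y ^ n) hsum
    Metric.isOpen_ball (convex_ball (0 : ℝ) r).isPreconnected
    (fun n y _ => (hasDerivAt_pow n y).const_mul (c n)) hbound hxb (hc.summable hx) hxb
  refine h.congr_deriv ?_
  have hs : Summable fun n : ℕ => c n * (n * x ^ (n - 1)) :=
    Summable.of_norm_bounded hsum fun n => hbound n x hxb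
  rw [hs.tsum_eq_zero_add, powerSum]
  simp only [Nat.cast_zero, zero_mul, mul_zero, zero_add]
  exact tsum_congr fun n => by
    simp only [derivCoeff, Nat.add_sub_cancel]
    push_cast
    ring

/-- The coefficients of `F(a, b; 1; x)`. -/
noncomputable def hypCoeff (a b : ℝ) (n : ℕ) : ℝ :=
  (ascPochhammer ℝ n).eval a * (ascPochhammer ℝ n).eval b /
    ((ascPochhammer ℝ n).eval 1 * (Nat.factorial n))

lemma hypCoeff_zero (a b : ℝ) : hypCoeff a b 0 = 1 := by simp [hypCoeff]

lemma hypCoeff_succ (a b : ℝ) (n : ℕ) :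
    ((n : ℝ) + 1) ^ 2 * hypCoeff a b (n + 1) = (a + n) * (b + n) * hypCoeff a b n := by
  have h1 : (n.factorial : ℝ) ≠ 0 := by positivity
  have h2 : (n : ℝ) + 1 ≠ 0 := by positivity
  simp only [hypCoeff, ascPochhammer_succ_eval, ascPochhammer_eval_one, Nat.factorial_succ]
  push_cast
  field_simp
  ring

lemma hypCoeff_nonneg {a b : ℝ} (ha : 0 < a) (hb : 0 < b) (n : ℕ) : 0 ≤ hypCoeff a b n := by
  rw [hypCoeff, ascPochhammer_eval_one]
  have h1 := ascPochhammer_pos n a ha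
  have h2 := ascPochhammer_pos n b hb
  positivity

lemma hypCoeff_le_one {a b : ℝ} (ha : 0 < a) (hb : 0 < b) (hab : a + b = 1) (n : ℕ) :
    hypCoeff a b n ≤ 1 := by
  induction n with
  | zero => rw [hypCoeff_zero]
  | succ n ih =>
    have h := hypCoeff_succ a b n
    have hn : (0 : ℝ) ≤ n := n.cast_nonneg
    have h0 := hypCoeff_nonneg ha hb n
    have h1 : (a + n) * (b + n) ≤ ((n : ℝ) + 1) ^ 2 := by nlinarith
    have h2 : ((n : ℝ) + 1) ^ 2 * hypCoeff a b (n + 1) ≤ ((n : ℝ) + 1) ^ 2 * 1 := by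
      rw [h]
      exact mul_le_mul h1 ih h0 (by positivity)
    exact le_of_mul_le_mul_left h2 (by positivity)

lemma polyBounded_hypCoeff {a b : ℝ} (ha : 0 < a) (hb : 0 < b) (hab : a + b = 1) :
    PolyBounded (hypCoeff a b) :=
  ⟨1, 0, fun n => by
    simpa [abs_of_nonneg (hypCoeff_nonneg ha hb n)] using hypCoeff_le_one ha hb hab n⟩

lemma hypF_one_eq_powerSum (a b : ℝ) : hypF a b 1 = powerSum (hypCoeff a b) := rfl

lemma hypF_zero (a b : ℝ) : hypF a b 1 0 = 1 := by
  rw [hypF_one_eq_powerSum, powerSum, tsum_eq_single 0 fun n hn => by simp [hn]]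
  simp [hypCoeff_zero]

lemma hypF_pos {a b : ℝ} (ha : 0 < a) (hb : 0 < b) (hab : a + b = 1) {x : ℝ} (hx0 : 0 ≤ x)
    (hx1 : x < 1) : 0 < hypF a b 1 x := by
  rw [hypF_one_eq_powerSum]
  refine ((polyBounded_hypCoeff ha hb hab).summable (by rwa [abs_of_nonneg hx0])).tsum_pos
    (fun n => mul_nonneg (hypCoeff_nonneg ha hb n) (pow_nonneg hx0 n)) 0 ?_
  simp [hypCoeff_zero]

/-- The derivative of `F(a, b; 1; x)` in `x`. -/
noncomputable def hypFDeriv (a b : ℝ) : ℝ → ℝ := powerSum (derivCoeff (hypCoeff a b))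

lemma hasDerivAt_hypF {a b : ℝ} (ha : 0 < a) (hb : 0 < b) (hab : a + b = 1) {x : ℝ}
    (hx : |x| < 1) : HasDerivAt (hypF a b 1) (hypFDeriv a b x) x :=
  hasDerivAt_powerSum (polyBounded_hypCoeff ha hb hab) hx

/-- The hypergeometric equation in self-adjoint form, for `c = a + b = 1`. -/
lemma hasDerivAt_mul_hypFDeriv {a b : ℝ} (ha : 0 < a) (hb : 0 < b) (hab : a + b = 1) {x : ℝ}
    (hx : |x| < 1) :
    HasDerivAt (fun t => t * (1 - t) * hypFDeriv a b t) (a * b * hypF a b 1 x) x := by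
  have hd := (polyBounded_hypCoeff ha hb hab).derivCoeff
  have ht := hd.shiftCoeff.sub hd.shiftCoeff.shiftCoeff
  have h := hasDerivAt_powerSum ht hx
  have hval : powerSum (derivCoeff (shiftCoeff (derivCoeff (hypCoeff a b)) -
      shiftCoeff (shiftCoeff (derivCoeff (hypCoeff a b))))) x = a * b * hypF a b 1 x := by
    rw [hypF_one_eq_powerSum, powerSum, powerSum, ← tsum_mul_left]
    refine tsum_congr fun n => ?_
    rw [← mul_assoc]
    congr 1
    have hrec := hypCoeff_succ a b n
    obtain rfl : b = 1 - a := by linarith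
    cases n with
    | zero =>
      simp only [derivCoeff, shiftCoeff, Pi.sub_apply]
      push_cast at hrec ⊢
      linear_combination hrec
    | succ n =>
      simp only [derivCoeff, shiftCoeff, Pi.sub_apply]
      push_cast at hrec ⊢
      linear_combination hrec
  rw [hval] at h
  refine h.congr_of_eventuallyEq ?_
  filter_upwards [(isOpen_lt continuous_abs continuous_const).mem_nhds hx] with t ht1
  rw [powerSum_sub hd.shiftCoeff hd.shiftCoeff.shiftCoeff ht1,
    powerSum_shiftCoeff hd.shiftCoeff ht1, powerSum_shiftCoeff hd ht1, hypFDeriv]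
  ring

/-- The modulus `α` in signature two. -/
noncomputable def quadModulus (p : ℝ) : ℝ := p ^ 3 * (2 + p) / (1 + 2 * p)

/-- The modulus `β` in signature three. -/
noncomputable def cubicModulus (p : ℝ) : ℝ :=
  (27/4) * (p ^ 2 * (1 + p) ^ 2 / (1 + p + p ^ 2) ^ 3)

lemma abs_quadModulus_lt_one {p : ℝ} (h0 : 0 ≤ p) (h1 : p < 1) : |quadModulus p| < 1 := by
  rw [quadModulus, abs_of_nonneg (by positivity), div_lt_one (by positivity)]
  have h : 0 < (1 - p) * (1 + p) ^ 3 := mul_pos (by linarith) (by positivity)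
  nlinarith

lemma cubicModulus_nonneg {p : ℝ} (h0 : 0 ≤ p) : 0 ≤ cubicModulus p := by
  rw [cubicModulus]
  positivity

lemma one_sub_cubicModulus {p : ℝ} (h0 : 0 ≤ p) :
    1 - cubicModulus p =
      ((1 - p) * (2 + p) * (1 + 2 * p)) ^ 2 / (4 * (1 + p + p ^ 2) ^ 3) := by
  have : 1 + p + p ^ 2 ≠ 0 := by positivity
  rw [cubicModulus]
  field_simp
  ring

lemma quadModulus_mul_one_sub {p : ℝ} (h0 : 0 ≤ p) :
    quadModulus p * (1 - quadModulus p) =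
      p ^ 3 * (2 + p) * ((1 - p) * (1 + p) ^ 3) / (1 + 2 * p) ^ 2 := by
  have : 1 + 2 * p ≠ 0 := by positivity
  rw [quadModulus]
  field_simp
  ring

lemma cubicModulus_mul_one_sub {p : ℝ} (h0 : 0 ≤ p) :
    cubicModulus p * (1 - cubicModulus p) =
      27 / 16 * (p * (1 + p) * ((1 - p) * (2 + p)) * (1 + 2 * p)) ^ 2 / (1 + p + p ^ 2) ^ 6 := by
  have : 1 + p + p ^ 2 ≠ 0 := by positivity
  rw [one_sub_cubicModulus h0, cubicModulus]
  field_simp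
  ring

lemma cubicModulus_lt_one {p : ℝ} (h0 : 0 ≤ p) (h1 : p < 1) : cubicModulus p < 1 := by
  have h := one_sub_cubicModulus h0
  have h2 : 0 < 1 - p := by linarith
  have : 0 < 1 - cubicModulus p := by rw [h]; positivity
  linarith

lemma hasDerivAt_quadModulus {p : ℝ} (h0 : 0 ≤ p) :
    HasDerivAt quadModulus (6 * (p * (1 + p)) ^ 2 / (1 + 2 * p) ^ 2) p := by
  have hp : 1 + 2 * p ≠ 0 := by positivity
  have h := (((hasDerivAt_pow 3 p).mul ((hasDerivAt_id' p).const_add 2)).div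
    (((hasDerivAt_id' p).const_mul 2).const_add 1) hp)
  refine h.congr_deriv ?_
  simp only [Pi.mul_apply]
  field_simp
  push_cast
  ring

lemma hasDerivAt_one_add_add_sq (p : ℝ) :
    HasDerivAt (fun t : ℝ => 1 + t + t ^ 2) (1 + 2 * p) p := by
  refine (((hasDerivAt_id' p).const_add 1).add (hasDerivAt_pow 2 p)).congr_deriv ?_
  norm_num

lemma hasDerivAt_cubicModulus {p : ℝ} (h0 : 0 ≤ p) :
    HasDerivAt cubicModulus (27 / 4 * (p * (1 + p) * ((1 - p) * (2 + p)) * (1 + 2 * p)) /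
      (1 + p + p ^ 2) ^ 4) p := by
  have hp : 1 + p + p ^ 2 ≠ 0 := by positivity
  have h := (((hasDerivAt_pow 2 p).mul (((hasDerivAt_id' p).const_add 1).pow 2)).div
    ((hasDerivAt_one_add_add_sq p).pow 3) (pow_ne_zero 3 hp)).const_mul (27 / 4)
  refine h.congr_deriv ?_
  simp only [Pi.mul_apply, Pi.pow_apply]
  field_simp
  push_cast
  ring

lemma hasDerivAt_sqrt_one_add_two_mul {p : ℝ} (h0 : 0 ≤ p) :
    HasDerivAt (fun t => √(1 + 2 * t)) (1 / √(1 + 2 * p)) p := by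
  have hp : 1 + 2 * p ≠ 0 := by positivity
  refine ((((hasDerivAt_id' p).const_mul 2).const_add 1).sqrt hp).congr_deriv ?_
  have : √(1 + 2 * p) ≠ 0 := by positivity
  field_simp

/-- The multiplier `m` relating the two signatures. -/
noncomputable def multiplier (p : ℝ) : ℝ := (1 + p + p ^ 2) / √(1 + 2 * p)

lemma hasDerivAt_multiplier {p : ℝ} (h0 : 0 ≤ p) :
    HasDerivAt multiplier (3 * (p * (1 + p)) / √(1 + 2 * p) ^ 3) p := by
  have hr : √(1 + 2 * p) ≠ 0 := by positivity
  have hsq : √(1 + 2 * p) ^ 2 = 1 + 2 * p := Real.sq_sqrt (by positivity)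
  refine ((hasDerivAt_one_add_add_sq p).div (hasDerivAt_sqrt_one_add_two_mul h0) hr).congr_deriv ?_
  field_simp
  rw [hsq]
  ring

lemma hasDerivAt_multiplier_inv {p : ℝ} (h0 : 0 ≤ p) :
    HasDerivAt (fun t => √(1 + 2 * t) / (1 + t + t ^ 2))
      (-3 * (p * (1 + p)) / (√(1 + 2 * p) * (1 + p + p ^ 2) ^ 2)) p := by
  have hr : √(1 + 2 * p) ≠ 0 := by positivity
  have hp : 1 + p + p ^ 2 ≠ 0 := by positivity
  have hsq : √(1 + 2 * p) ^ 2 = 1 + 2 * p := Real.sq_sqrt (by positivity)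
  refine ((hasDerivAt_sqrt_one_add_two_mul h0).div (hasDerivAt_one_add_add_sq p) hp).congr_deriv ?_
  field_simp
  rw [hsq]
  ring

/-- The product of the derivative of the multiplier with
the leading coefficient of the common equation. -/
noncomputable def crossCoeff (p : ℝ) : ℝ :=
  (p * (1 + p)) ^ 2 * ((1 - p) * (2 + p)) / (2 * (1 + p + p ^ 2) ^ 2 * √(1 + 2 * p))

lemma hasDerivAt_crossCoeff {p : ℝ} (h0 : 0 ≤ p) :
    HasDerivAt crossCoeff
      (p * (1 + p) * ((1 - p) * (2 + p)) * √(1 + 2 * p) / (1 + p + p ^ 2) ^ 3 -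
        3 * (p * (1 + p)) ^ 2 / (2 * √(1 + 2 * p) ^ 3 * (1 + p + p ^ 2))) p := by
  have hr : √(1 + 2 * p) ≠ 0 := by positivity
  have hp : 1 + p + p ^ 2 ≠ 0 := by positivity
  have hsq : √(1 + 2 * p) ^ 2 = 1 + 2 * p := Real.sq_sqrt (by positivity)
  have hnum := (((hasDerivAt_id' p).mul ((hasDerivAt_id' p).const_add 1)).pow 2).mul
    (((hasDerivAt_id' p).const_sub 1).mul ((hasDerivAt_id' p).const_add 2))
  have hden := (((hasDerivAt_one_add_add_sq p).pow 2).const_mul 2).mul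
    (hasDerivAt_sqrt_one_add_two_mul h0)
  refine (hnum.div hden (by simp only [Pi.mul_apply, Pi.pow_apply]; positivity)).congr_deriv ?_
  simp only [Pi.mul_apply, Pi.pow_apply]
  have hp2 : p = (√(1 + 2 * p) ^ 2 - 1) / 2 := by rw [hsq]; ring
  generalize √(1 + 2 * p) = r at *
  field_simp
  push_cast
  subst hp2
  ring

/-- The Wronskian of the two sides, multiplied by the leading coefficient. -/
noncomputable def weightedWronskian (p : ℝ) : ℝ :=
  √(1 + 2 * p) / (1 + p + p ^ 2) *
      (quadModulus p * (1 - quadModulus p) * hypFDeriv (1/2) (1/2) (quadModulus p)) *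
      hypF (1/3) (2/3) 1 (cubicModulus p) +
    crossCoeff p * hypF (1/2) (1/2) 1 (quadModulus p) * hypF (1/3) (2/3) 1 (cubicModulus p) -
    2 / 3 * multiplier p *
      (cubicModulus p * (1 - cubicModulus p) * hypFDeriv (1/3) (2/3) (cubicModulus p)) *
      hypF (1/2) (1/2) 1 (quadModulus p)

lemma hasDerivAt_quadHypF {p : ℝ} (h0 : 0 ≤ p) (h1 : p < 1) :
    HasDerivAt (fun t => hypF (1/2) (1/2) 1 (quadModulus t))
      (hypFDeriv (1/2) (1/2) (quadModulus p) * (6 * (p * (1 + p)) ^ 2 / (1 + 2 * p) ^ 2)) p :=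
  (hasDerivAt_hypF (by norm_num) (by norm_num) (by norm_num)
    (abs_quadModulus_lt_one h0 h1)).comp p (hasDerivAt_quadModulus h0)

lemma abs_cubicModulus_lt_one {p : ℝ} (h0 : 0 ≤ p) (h1 : p < 1) : |cubicModulus p| < 1 := by
  rw [abs_of_nonneg (cubicModulus_nonneg h0)]
  exact cubicModulus_lt_one h0 h1

lemma hasDerivAt_cubicHypF {p : ℝ} (h0 : 0 ≤ p) (h1 : p < 1) :
    HasDerivAt (fun t => hypF (1/3) (2/3) 1 (cubicModulus t))
      (hypFDeriv (1/3) (2/3) (cubicModulus p) *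
        (27 / 4 * (p * (1 + p) * ((1 - p) * (2 + p)) * (1 + 2 * p)) / (1 + p + p ^ 2) ^ 4)) p :=
  (hasDerivAt_hypF (by norm_num) (by norm_num) (by norm_num)
    (abs_cubicModulus_lt_one h0 h1)).comp p (hasDerivAt_cubicModulus h0)

lemma hasDerivAt_weightedWronskian {p : ℝ} (h0 : 0 ≤ p) (h1 : p < 1) :
    HasDerivAt weightedWronskian 0 p := by
  have hY := hasDerivAt_quadHypF h0 h1
  have hZ := hasDerivAt_cubicHypF h0 h1
  have hU := (hasDerivAt_mul_hypFDeriv (a := 1/2) (b := 1/2) (by norm_num) (by norm_num)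
    (by norm_num) (abs_quadModulus_lt_one h0 h1)).comp p (hasDerivAt_quadModulus h0)
  have hV := (hasDerivAt_mul_hypFDeriv (a := 1/3) (b := 2/3) (by norm_num) (by norm_num)
    (by norm_num) (abs_cubicModulus_lt_one h0 h1)).comp p (hasDerivAt_cubicModulus h0)
  have h := ((((hasDerivAt_multiplier_inv h0).mul hU).mul hZ).add
    (((hasDerivAt_crossCoeff h0).mul hY).mul hZ)).sub
    ((((hasDerivAt_multiplier h0).const_mul (2 / 3)).mul hV).mul hY)
  refine h.congr_deriv ?_
  simp only [Pi.mul_apply, Function.comp_apply]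
  have hr : √(1 + 2 * p) ≠ 0 := by positivity
  have hp : 1 + p + p ^ 2 ≠ 0 := by positivity
  have hsq : √(1 + 2 * p) ^ 2 = 1 + 2 * p := Real.sq_sqrt (by positivity)
  rw [quadModulus_mul_one_sub h0, cubicModulus_mul_one_sub h0]
  generalize hypF (1/2) (1/2) 1 (quadModulus p) = Y
  generalize hypF (1/3) (2/3) 1 (cubicModulus p) = Z
  generalize hypFDeriv (1/2) (1/2) (quadModulus p) = Y'
  generalize hypFDeriv (1/3) (2/3) (cubicModulus p) = Z'
  rw [crossCoeff, multiplier]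
  generalize √(1 + 2 * p) = r at hr hsq ⊢
  rw [← hsq]
  field_simp
  ring

lemma weightedWronskian_eq_zero {p : ℝ} (h0 : 0 ≤ p) (h1 : p < 1) : weightedWronskian p = 0 := by
  have h := constant_of_has_deriv_right_zero (f := weightedWronskian) (a := 0) (b := p)
    (fun x hx => (hasDerivAt_weightedWronskian hx.1
      (hx.2.trans_lt h1)).continuousAt.continuousWithinAt)
    (fun x hx => (hasDerivAt_weightedWronskian hx.1 (hx.2.trans h1)).hasDerivWithinAt)
    p ⟨h0, le_rfl⟩
  rw [h]
  simp [weightedWronskian, quadModulus, cubicModulus, crossCoeff]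

lemma hasDerivAt_ratio {p : ℝ} (h0 : 0 ≤ p) (h1 : p < 1) :
    HasDerivAt (fun t => multiplier t * hypF (1/2) (1/2) 1 (quadModulus t) /
      hypF (1/3) (2/3) 1 (cubicModulus t)) 0 p := by
  have hpos : 0 < hypF (1/3) (2/3) 1 (cubicModulus p) :=
    hypF_pos (by norm_num) (by norm_num) (by norm_num) (cubicModulus_nonneg h0)
      (cubicModulus_lt_one h0 h1)
  refine (((hasDerivAt_multiplier h0).mul (hasDerivAt_quadHypF h0 h1)).div
    (hasDerivAt_cubicHypF h0 h1) hpos.ne').congr_deriv ?_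
  rw [div_eq_zero_iff]
  left
  simp only [Pi.mul_apply]
  rcases h0.eq_or_lt with rfl | hp0
  · simp
  have hW := weightedWronskian_eq_zero h0 h1
  have hr : √(1 + 2 * p) ≠ 0 := by positivity
  have hp : 1 + p + p ^ 2 ≠ 0 := by positivity
  have hsq : √(1 + 2 * p) ^ 2 = 1 + 2 * p := Real.sq_sqrt (by positivity)
  have hP : p * (1 + p) * ((1 - p) * (2 + p)) * (1 + 2 * p) / (6 * (1 + p + p ^ 2) ^ 2) ≠ 0 := by
    have : 0 < 1 - p := by linarith
    positivity
  refine (mul_eq_zero.1 (Eq.trans ?_ hW)).resolve_left hP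
  rw [weightedWronskian, quadModulus_mul_one_sub h0, cubicModulus_mul_one_sub h0]
  generalize hypF (1/2) (1/2) 1 (quadModulus p) = Y
  generalize hypF (1/3) (2/3) 1 (cubicModulus p) = Z
  generalize hypFDeriv (1/2) (1/2) (quadModulus p) = Y'
  generalize hypFDeriv (1/3) (2/3) (cubicModulus p) = Z'
  rw [crossCoeff, multiplier]
  generalize √(1 + 2 * p) = r at hr hsq ⊢
  rw [← hsq]
  field_simp
  ring

theorem bbg_theorem_5_6 (p : ℝ) (hp0 : 0 < p) (hp1 : p < 1) :
    (1 + p + p ^ 2) * hypF (1/2) (1/2) 1 (p ^ 3 * (2 + p) / (1 + 2 * p)) =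
      Real.sqrt (1 + 2 * p) *
        hypF (1/3) (2/3) 1 ((27/4) * (p ^ 2 * (1 + p) ^ 2 / (1 + p + p ^ 2) ^ 3)) := by
  have h := constant_of_has_deriv_right_zero (a := 0) (b := p)
    (fun x hx => (hasDerivAt_ratio hx.1 (hx.2.trans_lt hp1)).continuousAt.continuousWithinAt)
    (fun x hx => (hasDerivAt_ratio hx.1 (hx.2.trans hp1)).hasDerivWithinAt)
    p ⟨hp0.le, le_rfl⟩
  have hpos : 0 < hypF (1/3) (2/3) 1 (cubicModulus p) :=
    hypF_pos (by norm_num) (by norm_num) (by norm_num) (cubicModulus_nonneg hp0.le)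
      (cubicModulus_lt_one hp0.le hp1)
  have hone : multiplier 0 * hypF (1/2) (1/2) 1 (quadModulus 0) /
      hypF (1/3) (2/3) 1 (cubicModulus 0) = 1 := by
    simp only [multiplier, quadModulus, cubicModulus]
    norm_num [hypF_zero]
  simp only [hone] at h
  rw [div_eq_one_iff_eq hpos.ne', multiplier, div_mul_eq_mul_div,
    div_eq_iff (by positivity), mul_comm (hypF _ _ _ _)] at h
  exact h
end

section
/- Let 0 < θ < π/2, put s = sin(θ/3), c = cos(θ/3), and define e₁ = (2/9)(8s⁴ − 12s² + 3), e₂ = (1/9)(−8s⁴ + 12s² − 3 + 8√3 s³c), e₃ = (1/9)(−8s⁴ + 12s² − 3 − 8√3 s³c). Then e₁ > e₂ > e₃. -/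
theorem midpoint_values_ordered (θ : ℝ) (hθ0 : 0 < θ) (hθ1 : θ < Real.pi / 2)
    (s c e₁ e₂ e₃ : ℝ)
    (hs : s = Real.sin (θ / 3)) (hc : c = Real.cos (θ / 3))
    (he₁ : e₁ = (2/9) * (8 * s ^ 4 - 12 * s ^ 2 + 3))
    (he₂ : e₂ = (1/9) * (-8 * s ^ 4 + 12 * s ^ 2 - 3 + 8 * Real.sqrt 3 * s ^ 3 * c))
    (he₃ : e₃ = (1/9) * (-8 * s ^ 4 + 12 * s ^ 2 - 3 - 8 * Real.sqrt 3 * s ^ 3 * c)) :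
    e₁ > e₂ ∧ e₂ > e₃ := by
  have hpi := Real.pi_pos
  have s_pos : 0 < s := hs ▸ Real.sin_pos_of_pos_of_lt_pi (by linarith) (by linarith)
  have c_pos : 0 < c := hc ▸ Real.cos_pos_of_mem_Ioo ⟨by linarith, by linarith⟩
  have s_lt : s < 1 / 2 := by
    rw [hs, ← Real.sin_pi_div_six]
    exact Real.sin_lt_sin_of_lt_of_le_pi_div_two (by linarith) (by linarith) (by linarith)
  have c_sq : c ^ 2 = 1 - s ^ 2 := by
    rw [hs, hc, Real.cos_sq']
  have sqrt_sq : Real.sqrt 3 ^ 2 = 3 := Real.sq_sqrt (by norm_num)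
  have t_pos : 0 < Real.sqrt 3 * s ^ 3 * c := by positivity
  have x_pos : 0 < s ^ 2 := by positivity
  have x_lt : s ^ 2 < 1 / 4 := by nlinarith
  have t_sq : (Real.sqrt 3 * s ^ 3 * c) ^ 2 = 3 * (s ^ 2) ^ 3 * (1 - s ^ 2) := by
    rw [mul_pow, mul_pow, sqrt_sq, c_sq]
    ring
  have t_lt : Real.sqrt 3 * s ^ 3 * c < 3 / 16 := by
    refine lt_of_pow_lt_pow_left₀ 2 (by norm_num) ?_
    rw [t_sq]
    generalize s ^ 2 = x at x_pos x_lt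
    have factor_pos : 0 < 3 / 64 + 3 / 16 * x + x ^ 2 * (3 / 4 - x) := by
      have : 0 < 3 / 4 - x := by linarith
      positivity
    nlinarith [mul_pos (sub_pos.mpr x_lt) factor_pos]
  constructor
  · rw [he₁, he₂]
    nlinarith [mul_pos (sub_pos.mpr x_lt) (show 0 < 5 / 4 - s ^ 2 by linarith)]
  · rw [he₂, he₃]
    linarith
end

section
/- Let 0 < p < 1, set s = (√3/2)·p/√(1 + p + p²), c = (1/2)·(2 + p)/√(1 + p + p²), and define e₁ = (2/9)(8s⁴ − 12s² + 3), e₂ = (1/9)(−8s⁴ + 12s² − 3 + 8√3 s³c), e₃ = (1/9)(−8s⁴ + 12s² − 3 − 8√3 s³c). Then (e₂ − e₃)/(e₁ − e₃) = p³(2 + p)/(1 + 2p). -/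
theorem jacobian_modulus_sq_in_terms_of_p (p : ℝ) (hp0 : 0 < p) (hp1 : p < 1)
    (s c e₁ e₂ e₃ : ℝ)
    (hs : s = (Real.sqrt 3 / 2) * p / Real.sqrt (1 + p + p ^ 2))
    (hc : c = (1/2) * (2 + p) / Real.sqrt (1 + p + p ^ 2))
    (he₁ : e₁ = (2/9) * (8 * s ^ 4 - 12 * s ^ 2 + 3))
    (he₂ : e₂ = (1/9) * (-8 * s ^ 4 + 12 * s ^ 2 - 3 + 8 * Real.sqrt 3 * s ^ 3 * c))
    (he₃ : e₃ = (1/9) * (-8 * s ^ 4 + 12 * s ^ 2 - 3 - 8 * Real.sqrt 3 * s ^ 3 * c)) :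
    (e₂ - e₃) / (e₁ - e₃) = p ^ 3 * (2 + p) / (1 + 2 * p) := by
  have hq : 0 < 1 + p + p ^ 2 := by positivity
  have hq_sqrt : Real.sqrt (1 + p + p ^ 2) ≠ 0 := (Real.sqrt_pos.mpr hq).ne'
  have hs_sq : s ^ 2 = 3 / 4 * p ^ 2 / (1 + p + p ^ 2) := by
    rw [hs, div_pow, mul_pow, div_pow, Real.sq_sqrt hq.le, Real.sq_sqrt (by norm_num)]
    norm_num
  have hsc : Real.sqrt 3 * s * c = 3 / 4 * (p * (2 + p)) / (1 + p + p ^ 2) := by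
    calc Real.sqrt 3 * s * c
        = Real.sqrt 3 ^ 2 * (p * (2 + p)) / 4 / Real.sqrt (1 + p + p ^ 2) ^ 2 := by
          rw [hs, hc]
          field_simp
          ring
      _ = 3 / 4 * (p * (2 + p)) / (1 + p + p ^ 2) := by
          rw [Real.sq_sqrt hq.le, Real.sq_sqrt (by norm_num)]
          ring
  have h₂₃ : e₂ - e₃ = p ^ 3 * (2 + p) / (1 + p + p ^ 2) ^ 2 := by
    calc e₂ - e₃ = 16 / 9 * s ^ 2 * (Real.sqrt 3 * s * c) := by rw [he₂, he₃]; ring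
      _ = p ^ 3 * (2 + p) / (1 + p + p ^ 2) ^ 2 := by
          rw [hs_sq, hsc]
          field_simp
          ring
  have h₁₃ : e₁ - e₃ = (1 + 2 * p) / (1 + p + p ^ 2) ^ 2 := by
    calc e₁ - e₃
        = 8 / 3 * (s ^ 2) ^ 2 - 4 * s ^ 2 + 1 + 8 / 9 * s ^ 2 * (Real.sqrt 3 * s * c) := by
          rw [he₁, he₃]; ring
      _ = (1 + 2 * p) / (1 + p + p ^ 2) ^ 2 := by
          rw [hs_sq, hsc]
          field_simp
          ring
  rw [h₂₃, h₁₃]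
  exact div_div_div_cancel_right₀ (pow_ne_zero 2 hq.ne') _ _
end
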